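/- arXiv:1406.4557 — 2 statements merged into one kernel-verified Lean document; each statement's English description precedes it below -/
import Mathlib

section
/- Let d ≥ 3 and let G be a finite d-regular graph with no half-loops, on n vertices. Then, as an identity of polynomials in the variable u, det(I − u·H_G) = det(I − u·A_G + u²(d−1)·I) · (1 − u²)^{nd/2 − n}. (Here nd/2 − n = |E_G| − |V_G| = −χ(G), the negative of the Euler characteristic of G.) -/
/-!
STATEMENT 0: Ihara determinantal formula for a finite `d`-regular graph `G`
(no half-loops) on `n` vertices:
`det(I − u·H_G) = det(I − u·A_G + u²(d−1)·I) · (1 − u²)^{nd/2 − n}`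
as an identity of polynomials in `u`.
-/

/-- A finite undirected multigraph: a directed graph `(V, E, t, h)` together with
an involution `ι` on directed edges satisfying `t ∘ ι = h`. -/
structure GraphOn (V E : Type) where
  t : E → V
  h : E → V
  ι : E → E
  ι_invol : ∀ e, ι (ι e) = e
  t_ι : ∀ e, t (ι e) = h e

/-- The adjacency matrix of a graph: the `(v,w)` entry is the number of directed
edges with tail `v` and head `w`. -/
noncomputable def adjMat {V E : Type} [Fintype E] [DecidableEq V]
    (G : GraphOn V E) : Matrix V V ℂ :=
  Matrix.of fun v w => ((Finset.univ.filter (fun e : E => G.t e = v ∧ G.h e = w)).card : ℂ)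

/-- The Hashimoto matrix of a graph: the `(e,f)` entry is `1` if `h(e) = t(f)`
and `ι(e) ≠ f`, and `0` otherwise. -/
noncomputable def hashimoto {V E : Type} [DecidableEq V] [DecidableEq E]
    (G : GraphOn V E) : Matrix E E ℂ :=
  Matrix.of fun e f => if G.h e = G.t f ∧ G.ι e ≠ f then 1 else 0

/-- `G` is `d`-regular: every vertex is the tail of exactly `d` directed edges. -/
def IsRegularGraph {V E : Type} [Fintype E] [DecidableEq V] (G : GraphOn V E) (d : ℕ) : Prop :=
  ∀ v : V, (Finset.univ.filter (fun e : E => G.t e = v)).card = d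

/-- The matrix with `(a, b)` entry `1` if `f a = b` and `0` otherwise. -/
def mapMatrix {α β : Type*} [DecidableEq β] (R : Type*) [CommRing R] (f : α → β) :
    Matrix α β R :=
  Matrix.of fun a b => if f a = b then 1 else 0

section MapMatrix

variable {α β γ : Type*} [DecidableEq β] {R : Type*} [CommRing R]

theorem mapMatrix_mul [Fintype β] (f : α → β) (M : Matrix β γ R) :
    mapMatrix R f * M = Matrix.of fun a c => M (f a) c := by
  ext a c
  simp [mapMatrix, Matrix.mul_apply]

theorem mapMatrix_mul_mapMatrix [Fintype β] [DecidableEq γ] (f : α → β) (g : β → γ) :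
    mapMatrix R f * mapMatrix R g = mapMatrix R (g ∘ f) := by
  rw [mapMatrix_mul]
  rfl

theorem mapMatrix_mul_self [Fintype β] {f : β → β} (hf : Function.Involutive f) :
    mapMatrix R f * mapMatrix R f = 1 := by
  rw [mapMatrix_mul_mapMatrix, hf.comp_self]
  ext a b
  simp [mapMatrix, Matrix.one_apply]

end MapMatrix

theorem even_card_of_involutive_of_ne {E : Type*} [Fintype E] {f : E → E}
    (hf : Function.Involutive f) (hne : ∀ e, f e ≠ e) : Even (Fintype.card E) := by
  have h : ∑ _e : E, (1 : ZMod 2) = 0 :=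
    Finset.sum_involution (fun e _ => f e) (fun _ _ => by decide) (fun e _ _ => hne e)
      (fun _ _ => Finset.mem_univ _) (fun e _ => hf e)
  rw [even_iff_two_dvd, ← ZMod.natCast_eq_zero_iff]
  simpa using h

theorem exists_sign_of_involutive_of_ne {E : Type*} [Fintype E] {f : E → E}
    (hf : Function.Involutive f) (hne : ∀ e, f e ≠ e) :
    ∃ s : E → ℤˣ, ∀ e, s (f e) = -s e := by
  let φ := Fintype.equivFin E
  refine ⟨fun e => if φ e < φ (f e) then 1 else -1, fun e => ?_⟩
  have h : φ (f e) ≠ φ e := φ.injective.ne (hne e)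
  rcases lt_or_gt_of_ne h with h | h <;> simp [hf e, h, h.not_gt]

section Involution

variable {E : Type*} [Fintype E] [DecidableEq E] {f : E → E}

theorem one_sub_mul_one_add_mapMatrix {R : Type*} [CommRing R] (hf : Function.Involutive f)
    (u : R) :
    (1 - u • mapMatrix R f) * (1 + u • mapMatrix R f) = (1 - u ^ 2) • (1 : Matrix E E R) := by
  have h := mapMatrix_mul_self (R := R) hf
  simp only [sub_mul, mul_add, one_mul, mul_one, smul_mul_assoc, mul_smul_comm, h]
  module

theorem det_one_add_smul_mapMatrix {R : Type*} [CommRing R] (hf : Function.Involutive f)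
    (hne : ∀ e, f e ≠ e) (u : R) :
    (1 + u • mapMatrix R f).det = (1 - u • mapMatrix R f).det := by
  obtain ⟨s, hs⟩ := exists_sign_of_involutive_of_ne hf hne
  let K : Matrix E E R := Matrix.diagonal fun e => ((s e : ℤ) : R)
  have hsq : ∀ e, ((s e : ℤ) : R) * ((s e : ℤ) : R) = 1 := fun e => by
    rw [← Int.cast_mul, ← Units.val_mul, Int.units_mul_self]
    simp
  have hK : K * K = 1 := by
    simp only [K, Matrix.diagonal_mul_diagonal, hsq, Matrix.diagonal_one]
  have hconj : K * (1 - u • mapMatrix R f) * K = 1 + u • mapMatrix R f := by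
    have hJ : K * mapMatrix R f * K = -mapMatrix R f := by
      ext a b
      simp only [K, Matrix.mul_diagonal, Matrix.diagonal_mul, mapMatrix, Matrix.of_apply,
        Matrix.neg_apply]
      split_ifs with h
      · subst h
        simp [hs, hsq]
      · simp
    rw [mul_sub, sub_mul, mul_one, hK, mul_smul_comm, smul_mul_assoc, hJ, smul_neg, sub_neg_eq_add]
  rw [← hconj, Matrix.det_mul, Matrix.det_mul, mul_right_comm, ← Matrix.det_mul, hK,
    Matrix.det_one, one_mul]

open Polynomial in
theorem det_one_sub_X_smul_mapMatrix {R : Type*} [CommRing R] [IsDomain R] [CharZero R]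
    (hf : Function.Involutive f) (hne : ∀ e, f e ≠ e) :
    (1 - (X : R[X]) • mapMatrix R[X] f).det = (1 - X ^ 2) ^ (Fintype.card E / 2) := by
  have hsq : (1 - (X : R[X]) • mapMatrix R[X] f).det ^ 2
      = ((1 - X ^ 2) ^ (Fintype.card E / 2)) ^ 2 := by
    rw [← pow_mul, Nat.div_mul_cancel (even_card_of_involutive_of_ne hf hne).two_dvd, pow_two]
    nth_rw 2 [← det_one_add_smul_mapMatrix hf hne]
    rw [← Matrix.det_mul, one_sub_mul_one_add_mapMatrix hf, Matrix.det_smul, Matrix.det_one,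
      mul_one]
  refine (sq_eq_sq_iff_eq_or_eq_neg.mp hsq).resolve_right fun h => ?_
  have h0 := congrArg (evalRingHom (0 : R)) h
  rw [RingHom.map_det] at h0
  have hmap : (evalRingHom (0 : R)).mapMatrix (1 - (X : R[X]) • mapMatrix R[X] f) = 1 := by
    ext a b
    simp [Matrix.one_apply, apply_ite]
  rw [hmap, Matrix.det_one] at h0
  simp only [map_neg, map_pow, map_sub, map_one, coe_evalRingHom, eval_X] at h0
  norm_num at h0

end Involution

theorem pow_card_mul_det_smul_one_sub_mul_comm {V E R : Type*} [Fintype V] [DecidableEq V]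
    [Fintype E] [DecidableEq E] [CommRing R] (x : R) (B : Matrix E V R) (T : Matrix V E R) :
    x ^ Fintype.card V * (x • (1 : Matrix E E R) - B * T).det
      = x ^ Fintype.card E * (x • (1 : Matrix V V R) - T * B).det := by
  have h := congrArg (Polynomial.eval x) (Matrix.charpoly_mul_comm' B T)
  simpa [Matrix.eval_charpoly, Matrix.scalar_apply, Matrix.smul_one_eq_diagonal] using h

theorem GraphOn.h_ι {V E : Type} (G : GraphOn V E) (e : E) : G.h (G.ι e) = G.t e := by
  rw [← G.t_ι, G.ι_invol]

section GraphMatrices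

variable {V E : Type} [DecidableEq V] (G : GraphOn V E)

theorem hashimoto_map [Fintype V] [DecidableEq E] (R : Type*) [CommRing R] (φ : ℂ →+* R) :
    (hashimoto G).map φ
      = mapMatrix R G.h * (mapMatrix R G.t).transpose - mapMatrix R G.ι := by
  ext e f
  have h : G.ι e = f → G.t f = G.h e := fun h => by rw [← h, G.t_ι]
  rw [mapMatrix_mul, Matrix.sub_apply]
  by_cases hi : G.ι e = f
  · simp [hashimoto, mapMatrix, hi, h hi]
  · simp [hashimoto, mapMatrix, hi, eq_comm (a := G.h e), apply_ite φ]

theorem adjMat_map [Fintype E] (R : Type*) [CommRing R] (φ : ℂ →+* R) :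
    (adjMat G).map φ = (mapMatrix R G.t).transpose * mapMatrix R G.h := by
  ext v w
  simp [adjMat, Matrix.mul_apply, mapMatrix, ← ite_and, Finset.sum_boole, and_comm]

variable {G} in
theorem IsRegularGraph.transpose_mul_mapMatrix [Fintype E] {d : ℕ} (hreg : IsRegularGraph G d) (R : Type*)
    [CommRing R] :
    (mapMatrix R G.t).transpose * mapMatrix R G.t = (d : R) • (1 : Matrix V V R) := by
  ext v w
  by_cases hvw : v = w
  · subst hvw
    simp [Matrix.mul_apply, mapMatrix, ← ite_and, Finset.sum_boole, hreg v]
  · have h : ∀ e, G.t e = v → G.t e ≠ w := fun e he => he ▸ hvw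
    simp only [Matrix.mul_apply, mapMatrix, Matrix.transpose_apply, Matrix.of_apply, ite_mul,
      one_mul, zero_mul, Matrix.smul_apply, Matrix.one_apply_ne hvw, smul_zero]
    refine Finset.sum_eq_zero fun e _ => ?_
    split_ifs <;> simp_all

variable {G} in
theorem IsRegularGraph.card_edges [Fintype V] [Fintype E] {d : ℕ} (hreg : IsRegularGraph G d) :
    Fintype.card E = Fintype.card V * d := by
  rw [← Finset.card_univ, Finset.card_eq_sum_card_fiberwise (f := G.t) (t := Finset.univ)
    fun _ _ => Finset.mem_coe.mpr (Finset.mem_univ _), Finset.sum_congr rfl fun v _ => hreg v]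
  simp

variable {G} in
theorem IsRegularGraph.pow_mul_det_one_sub_mul_det_hashimoto [Fintype V] [Fintype E]
    [DecidableEq E] {d : ℕ} (hreg : IsRegularGraph G d) {R : Type*} [CommRing R] (φ : ℂ →+* R) (u : R) :
    (1 - u ^ 2) ^ Fintype.card V
        * ((1 - u • mapMatrix R G.ι).det * (1 - u • (hashimoto G).map φ).det)
      = (1 - u ^ 2) ^ Fintype.card E
        * (1 - u • (adjMat G).map φ + (u ^ 2 * ((d : R) - 1)) • (1 : Matrix V V R)).det := by
  have hE : (1 - u • mapMatrix R G.ι) * (1 - u • (hashimoto G).map φ)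
      = (1 - u ^ 2) • (1 : Matrix E E R)
        - ((1 - u • mapMatrix R G.ι) * (u • mapMatrix R G.h)) * (mapMatrix R G.t).transpose := by
    rw [← one_sub_mul_one_add_mapMatrix G.ι_invol, Matrix.mul_assoc, ← mul_sub, hashimoto_map,
      Matrix.smul_mul, smul_sub]
    congr 1
    abel
  have hι : mapMatrix R G.ι * mapMatrix R G.h = mapMatrix R G.t := by
    rw [mapMatrix_mul_mapMatrix]
    exact congrArg _ (funext G.h_ι)
  have hV : (mapMatrix R G.t).transpose * ((1 - u • mapMatrix R G.ι) * (u • mapMatrix R G.h))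
      = u • (adjMat G).map φ - (u ^ 2 * d) • (1 : Matrix V V R) := by
    rw [Matrix.sub_mul, Matrix.one_mul, Matrix.smul_mul, Matrix.mul_smul, hι, Matrix.mul_sub,
      Matrix.mul_smul, Matrix.mul_smul, Matrix.mul_smul, hreg.transpose_mul_mapMatrix,
      adjMat_map, smul_smul, smul_smul, pow_two]
  rw [← Matrix.det_mul, hE, pow_card_mul_det_smul_one_sub_mul_comm, hV]
  congr 2
  module

end GraphMatrices

theorem stmt0 {V E : Type} [Fintype V] [DecidableEq V] [Fintype E] [DecidableEq E]
    (G : GraphOn V E) (d : ℕ) (hd : 3 ≤ d)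
    (hreg : IsRegularGraph G d)
    (hnohalf : ∀ e : E, G.ι e ≠ e) :
    Matrix.det ((1 : Matrix E E (Polynomial ℂ))
        - (Polynomial.X : Polynomial ℂ) • (hashimoto G).map Polynomial.C)
      = Matrix.det ((1 : Matrix V V (Polynomial ℂ))
            - (Polynomial.X : Polynomial ℂ) • (adjMat G).map Polynomial.C
            + ((Polynomial.X : Polynomial ℂ) ^ 2 * Polynomial.C ((d : ℂ) - 1)) • (1 : Matrix V V (Polynomial ℂ)))
        * (1 - Polynomial.X ^ 2) ^ (Fintype.card V * d / 2 - Fintype.card V) := by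
  have hcard := hreg.card_edges
  have heven := even_card_of_involutive_of_ne G.ι_invol hnohalf
  have hle : Fintype.card V ≤ Fintype.card E / 2 := by
    rw [Nat.le_div_iff_mul_le two_pos, hcard]
    exact Nat.mul_le_mul_left _ (by lia)
  have hx : (1 - Polynomial.X ^ 2 : Polynomial ℂ) ≠ 0 := fun h => by
    simpa using congrArg (Polynomial.eval 0) h
  have key := hreg.pow_mul_det_one_sub_mul_det_hashimoto Polynomial.C Polynomial.X
  rw [det_one_sub_X_smul_mapMatrix G.ι_invol hnohalf, ← mul_assoc, ← pow_add] at key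
  have hexp : Fintype.card E = (Fintype.card V + Fintype.card E / 2)
      + (Fintype.card E / 2 - Fintype.card V) := by
    have := Nat.div_mul_cancel heven.two_dvd
    lia
  nth_rw 2 [hexp] at key
  rw [pow_add _ (_ + _), mul_assoc] at key
  rw [← hcard, mul_left_cancel₀ (pow_ne_zero _ hx) key, mul_comm]
  simp
end

section
/- Let d ≥ 3 and let G be a finite d-regular graph with no half-loops, on n vertices. Then the Hashimoto matrix H_G is invertible, and for every integer k ≥ 0, Tr(H_G^{−k}) = (1 + (−1)^k)·n(d−2)/2 + ( Tr(H_G^k) − (1 + (−1)^k)·n(d−2)/2 )·(d−1)^{−k}. -/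
namespace Matrix

open Polynomial

variable {m n : Type*} [Fintype m] [DecidableEq m] [Fintype n] [DecidableEq n]

section TracePow

variable {K : Type*} [Field K] [IsAlgClosed K]

theorem det_sub_scalar_eq_prod_roots_charpoly (M : Matrix m m K) (a : K) :
    (M - scalar m a).det = (M.charpoly.roots.map fun r => r - a).prod := by
  have hs := IsAlgClosed.splits M.charpoly
  have hcard : M.charpoly.roots.card = Fintype.card m := by
    rw [← hs.natDegree_eq_card_roots, charpoly_natDegree_eq_dim]
  have h := M.eval_charpoly a
  rw [← neg_sub, det_neg, ← h, hs.eval_eq_prod_roots_of_monic M.charpoly_monic, ← hcard,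
    ← Multiset.card_map (fun r => a - r), ← Multiset.prod_map_neg, Multiset.map_map]
  simp

theorem det_aeval_eq_prod_roots_charpoly (M : Matrix m m K) (p : K[X]) :
    (aeval M p).det = (M.charpoly.roots.map fun r => p.eval r).prod := by
  have hcard : M.charpoly.roots.card = Fintype.card m := by
    rw [← (IsAlgClosed.splits M.charpoly).natDegree_eq_card_roots, charpoly_natDegree_eq_dim]
  have hmul (p q : K[X]) (hp : (aeval M p).det = (M.charpoly.roots.map fun r => p.eval r).prod)
      (hq : (aeval M q).det = (M.charpoly.roots.map fun r => q.eval r).prod) :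
      (aeval M (p * q)).det = (M.charpoly.roots.map fun r => (p * q).eval r).prod := by
    simp [hp, hq, Multiset.prod_map_mul]
  have hC (a : K) : (aeval M (C a)).det = (M.charpoly.roots.map fun r => (C a).eval r).prod := by
    simp [algebraMap_eq_diagonal, hcard]
  rw [(IsAlgClosed.splits p).eq_prod_roots]
  refine hmul _ _ (hC _) ?_
  induction p.roots using Multiset.induction_on with
  | empty => simp
  | cons a s ih =>
    rw [Multiset.map_cons, Multiset.prod_cons]
    refine hmul _ _ ?_ ih
    simpa [algebraMap_eq_diagonal, Pi.algebraMap_def] using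
      M.det_sub_scalar_eq_prod_roots_charpoly a

theorem charpoly_pow_eq_prod_roots_charpoly (M : Matrix m m K) (k : ℕ) :
    (M ^ k).charpoly = ((M.charpoly.roots.map (· ^ k)).map fun r => X - C r).prod := by
  refine Polynomial.funext fun t => ?_
  have h := M.det_aeval_eq_prod_roots_charpoly (C t - X ^ k)
  simp only [map_sub, aeval_C, map_pow, aeval_X, eval_sub, eval_C, eval_pow, eval_X] at h
  rw [eval_charpoly, eval_multiset_prod, Multiset.map_map, Multiset.map_map]
  simpa [Function.comp_def, algebraMap_eq_diagonal, Pi.algebraMap_def] using h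

theorem trace_pow_eq_sum_roots_charpoly (M : Matrix m m K) (k : ℕ) :
    (M ^ k).trace = (M.charpoly.roots.map (· ^ k)).sum := by
  rw [trace_eq_sum_roots_charpoly, charpoly_pow_eq_prod_roots_charpoly,
    roots_multiset_prod_X_sub_C]

end TracePow

section Involution

variable {K : Type*} [Field K] {P : Matrix m m K} {T : Matrix m n K} {U : Matrix n m K} {d : K}

theorem det_smul_one_add_smul_sub_mul (hP : P * P = 1) (hUPT : U * P * T = d • 1)
    {x s : K} (hx : x ^ 2 - s ^ 2 ≠ 0) :
    (x • 1 + s • P - T * U).det * (x ^ 2 - s ^ 2) ^ Fintype.card n =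
      (x • 1 + s • P).det * ((x ^ 2 - s ^ 2 + s * d) • 1 - x • (U * T)).det := by
  set c := x ^ 2 - s ^ 2 with hc
  have hB : (x • 1 + s • P) * (x • 1 - s • P) = c • (1 : Matrix m m K) := by
    simp only [add_mul, mul_sub, smul_mul_smul_comm, hP, one_mul, mul_one, hc]
    module
  have hfac : x • 1 + s • P - T * U =
      (x • 1 + s • P) * (1 - (c⁻¹ • ((x • 1 - s • P) * T)) * U) := by
    rw [mul_sub, mul_one, Matrix.smul_mul, Matrix.mul_smul, ← Matrix.mul_assoc,
      ← Matrix.mul_assoc, hB, Matrix.smul_mul, Matrix.smul_mul, smul_smul, inv_mul_cancel₀ hx, one_smul, Matrix.one_mul]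
  have hsmall : c • (1 - U * (c⁻¹ • ((x • 1 - s • P) * T))) =
      (c + s * d) • 1 - x • (U * T) := by
    rw [Matrix.mul_smul, smul_sub, smul_smul, mul_inv_cancel₀ hx, one_smul, Matrix.sub_mul,
      Matrix.mul_sub, Matrix.smul_mul, Matrix.smul_mul, Matrix.mul_smul, Matrix.mul_smul,
      ← Matrix.mul_assoc U P, hUPT, Matrix.one_mul]
    module
  rw [hfac, det_mul, det_one_sub_mul_comm, ← hsmall, det_smul]
  ring

theorem charpoly_mul_sub_involution [Infinite K] (hP : P * P = 1) (hUPT : U * P * T = d • 1) :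
    (T * U - (d - 1) • P).charpoly * (((d - 1) • 1 : Matrix n n K).charpoly *
        ((-(d - 1)) • 1 : Matrix n n K).charpoly) * ((-1 : K) • P).charpoly =
      (T * U - P).charpoly * ((1 : Matrix n n K).charpoly *
        ((-1 : K) • 1 : Matrix n n K).charpoly) * ((-(d - 1)) • P).charpoly := by
  refine eq_of_infinite_eval_eq _ _ <| Set.Infinite.mono (s := {1, -1, d - 1, -(d - 1)}ᶜ) ?_
    (Set.Finite.infinite_compl (by simp))
  intro x hx
  simp only [Set.mem_compl_iff, Set.mem_insert_iff, Set.mem_singleton_iff, not_or] at hx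
  obtain ⟨h1, h2, h3, h4⟩ := hx
  have hx1 : x ^ 2 - 1 ^ 2 ≠ 0 := by
    rw [sq_sub_sq]
    exact mul_ne_zero (fun h => h2 (eq_neg_of_add_eq_zero_left h)) (sub_ne_zero.2 h1)
  have hxq : x ^ 2 - (d - 1) ^ 2 ≠ 0 := by
    rw [sq_sub_sq]
    exact mul_ne_zero (fun h => h4 (eq_neg_of_add_eq_zero_left h)) (sub_ne_zero.2 h3)
  have e1 := det_smul_one_add_smul_sub_mul hP hUPT hx1
  have eq := det_smul_one_add_smul_sub_mul hP hUPT hxq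
  have hscal (a : K) : (x • 1 - a • 1 : Matrix n n K).det = (x - a) ^ Fintype.card n := by
    rw [← sub_smul, det_smul, det_one, mul_one]
  have hscal1 : (x • 1 - 1 : Matrix n n K).det = (x - 1) ^ Fintype.card n := by
    simpa using hscal 1
  have hm (M : Matrix m m K) (s : K) : x • 1 - (M - s • P) = x • 1 + s • P - M := by abel
  have hm1 (M : Matrix m m K) : x • 1 - (M - P) = x • 1 + (1 : K) • P - M := by
    rw [one_smul]; abel
  have hm' (s : K) : x • 1 - (-s) • P = x • 1 + s • P := by rw [neg_smul, sub_neg_eq_add]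
  simp only [Set.mem_ofPred_eq, eval_mul, eval_charpoly, scalar_apply, ← smul_one_eq_diagonal,
    hscal, hscal1, hm, hm1, hm', ← mul_pow]
  have h5 : (x - (d - 1)) * (x - -(d - 1)) = x ^ 2 - (d - 1) ^ 2 := by ring
  have h6 : (x - 1) * (x - -1) = x ^ 2 - 1 ^ 2 := by ring
  have h7 : x ^ 2 - (d - 1) ^ 2 + (d - 1) * d = x ^ 2 - 1 ^ 2 + 1 * d := by ring
  rw [h5, h6, e1, eq, h7]
  ring

theorem trace_involution_pow [NeZero (2 : K)] (hP : P * P = 1) (htr : P.trace = 0)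
    (k : ℕ) : (P ^ k).trace = (1 + (-1) ^ k) / 2 * Fintype.card m := by
  have h2 : (2 : K) ≠ 0 := NeZero.ne 2
  obtain ⟨j, rfl | rfl⟩ := k.even_or_odd'
  · rw [pow_mul, pow_two, hP, one_pow, trace_one, pow_mul]
    norm_num
    field_simp
  · rw [pow_succ, pow_mul, pow_two, hP, one_pow, one_mul, htr, pow_succ, pow_mul]
    norm_num

theorem trace_mul_sub_involution_pow [IsAlgClosed K] [NeZero (2 : K)]
    (hP : P * P = 1) (htr : P.trace = 0) (hUPT : U * P * T = d • 1) (k : ℕ) :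
    ((T * U - (d - 1) • P) ^ k).trace = ((T * U - P) ^ k).trace +
      (1 + (-1) ^ k) / 2 * (Fintype.card m - 2 * Fintype.card n) * ((d - 1) ^ k - 1) := by
  have : Infinite K := IsAlgClosed.instInfinite
  have h := congrArg (fun p => (p.roots.map (· ^ k)).sum) (charpoly_mul_sub_involution hP hUPT)
  have hne (N : Matrix m m K) := N.charpoly_monic.ne_zero
  have hne' (N : Matrix n n K) := N.charpoly_monic.ne_zero
  simp only [roots_mul, ne_eq, mul_eq_zero, hne, hne', or_self, not_false_eq_true,
    Multiset.map_add, Multiset.sum_add, ← trace_pow_eq_sum_roots_charpoly,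
    _root_.smul_pow, one_pow, trace_smul, trace_one, smul_eq_mul] at h
  have h2 : (2 : K)⁻¹ * 2 = 1 := inv_mul_cancel₀ (NeZero.ne 2)
  have hsq : ((-1 : K) ^ k) * (-1) ^ k = 1 := by rw [← mul_pow]; norm_num
  rw [neg_pow (d - 1) k] at h
  linear_combination h - (-1) ^ k * (1 - (d - 1) ^ k) * trace_involution_pow hP htr k
    - (Fintype.card m : K) / 2 * (1 - (d - 1) ^ k) * hsq
    + Fintype.card n * (1 + (-1) ^ k) * ((d - 1) ^ k - 1) * h2

theorem smul_involution_mul_mul_eq_one (hP : P * P = 1) (hUPT : U * P * T = d • 1)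
    (hd : d - 1 ≠ 0) :
    ((d - 1)⁻¹ • (P * (T * U - (d - 1) • P) * P)) * (T * U - P) = 1 := by
  have h1 : P * (T * U - (d - 1) • P) * P * (T * U - P) =
      P * T * (U * P * T) * U - P * T * U * (P * P) - (d - 1) • (P * P * P * T * U)
        + (d - 1) • (P * P * (P * P)) := by
    simp only [Matrix.mul_sub, Matrix.sub_mul, Matrix.mul_assoc, Matrix.smul_mul, Matrix.mul_smul]
    abel
  rw [Matrix.smul_mul, h1, hUPT, hP]
  simp only [Matrix.mul_one, Matrix.one_mul, Matrix.mul_smul, Matrix.smul_mul]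
  rw [show d • (P * T * U) - P * T * U - (d - 1) • (P * T * U) + (d - 1) • (1 : Matrix m m K) =
    (d - 1) • 1 by module, smul_smul, inv_mul_cancel₀ hd, one_smul]

end Involution

end Matrix

namespace GraphOn

variable {V E : Type} (G : GraphOn V E)

/-- The incidence matrix of directed edges with their heads. -/
def headMatrix [DecidableEq V] : Matrix E V ℂ := Matrix.of fun e v => if G.h e = v then 1 else 0

/-- The incidence matrix of directed edges with their tails. -/
def tailMatrix [DecidableEq V] : Matrix V E ℂ := Matrix.of fun v e => if G.t e = v then 1 else 0

/-- The permutation matrix of the edge-reversing involution. -/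
def reversalMatrix [DecidableEq E] : Matrix E E ℂ := Matrix.of fun e f => if G.ι e = f then 1 else 0

theorem hashimoto_eq [DecidableEq V] [DecidableEq E] [Fintype V] :
    hashimoto G = G.headMatrix * G.tailMatrix - G.reversalMatrix := by
  ext e f
  have h : G.ι e = f → G.t f = G.h e := by rintro rfl; exact G.t_ι e
  by_cases h1 : G.ι e = f
  · simp [hashimoto, headMatrix, tailMatrix, reversalMatrix, Matrix.mul_apply, h1, h h1]
  · simp [hashimoto, headMatrix, tailMatrix, reversalMatrix, Matrix.mul_apply, h1, eq_comm (a := G.h e)]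

variable [Fintype E]

theorem reversalMatrix_mul_self [DecidableEq E] : G.reversalMatrix * G.reversalMatrix = 1 := by
  ext e f
  simp only [reversalMatrix, Matrix.mul_apply, Matrix.of_apply, ite_mul, one_mul, zero_mul,
    Finset.sum_ite_eq, Finset.mem_univ, if_true, G.ι_invol, Matrix.one_apply]

theorem trace_reversalMatrix [DecidableEq E] (hnohalf : ∀ e : E, G.ι e ≠ e) :
    G.reversalMatrix.trace = 0 := by
  simp [Matrix.trace, reversalMatrix, hnohalf]

theorem reversalMatrix_mul_headMatrix [DecidableEq V] [DecidableEq E] :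
    G.reversalMatrix * G.headMatrix = G.tailMatrix.transpose := by
  ext e v
  simp only [reversalMatrix, headMatrix, tailMatrix, Matrix.mul_apply, Matrix.of_apply, ite_mul,
    one_mul, zero_mul, Finset.sum_ite_eq, Finset.mem_univ, if_true, ← G.t_ι, G.ι_invol,
    Matrix.transpose_apply]

theorem tailMatrix_mul_reversalMatrix_mul_headMatrix [DecidableEq V] [DecidableEq E] {d : ℕ}
    (hreg : IsRegularGraph G d) :
    G.tailMatrix * G.reversalMatrix * G.headMatrix = (d : ℂ) • 1 := by
  rw [Matrix.mul_assoc, reversalMatrix_mul_headMatrix]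
  ext v w
  by_cases hvw : v = w
  · subst hvw
    simp [tailMatrix, Matrix.mul_apply, ← hreg v, ← ite_and]
  · have h (e : E) : ¬ (G.t e = w ∧ G.t e = v) := fun ⟨h1, h2⟩ => hvw (h2 ▸ h1)
    simp [tailMatrix, Matrix.mul_apply, hvw, ← ite_and, h]

theorem card_edges [Fintype V] [DecidableEq V] {d : ℕ} (hreg : IsRegularGraph G d) :
    Fintype.card E = Fintype.card V * d := by
  rw [← Finset.card_univ, Finset.card_eq_sum_card_fiberwise (f := G.t) (t := Finset.univ)
    (by simp), Finset.sum_congr rfl fun v _ => hreg v]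
  simp

end GraphOn

theorem stmt2 {V E : Type} [Fintype V] [DecidableEq V] [Fintype E] [DecidableEq E]
    (G : GraphOn V E) (d : ℕ) (hd : 3 ≤ d)
    (hreg : IsRegularGraph G d)
    (hnohalf : ∀ e : E, G.ι e ≠ e) :
    IsUnit (hashimoto G) ∧
    ∀ k : ℕ,
      Matrix.trace ((hashimoto G)⁻¹ ^ k)
        = (1 + (-1 : ℂ) ^ k) * ((Fintype.card V : ℂ) * ((d : ℂ) - 2)) / 2
          + (Matrix.trace ((hashimoto G) ^ k)
              - (1 + (-1 : ℂ) ^ k) * ((Fintype.card V : ℂ) * ((d : ℂ) - 2)) / 2)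
            * (((d : ℂ) - 1)⁻¹) ^ k := by
  have hH := G.hashimoto_eq
  have hP := G.reversalMatrix_mul_self
  have hUPT := G.tailMatrix_mul_reversalMatrix_mul_headMatrix hreg
  have hcard : (Fintype.card E : ℂ) = Fintype.card V * d := by
    exact_mod_cast G.card_edges hreg
  have hq : (d : ℂ) - 1 ≠ 0 := sub_ne_zero.2 (by exact_mod_cast (by omega : d ≠ 1))
  have hinv := Matrix.smul_involution_mul_mul_eq_one hP hUPT hq
  rw [← hH] at hinv
  refine ⟨(Matrix.isUnit_iff_isUnit_det _).2 (Matrix.isUnit_det_of_left_inverse hinv), fun k => ?_⟩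
  have hconj : (G.reversalMatrix * (G.headMatrix * G.tailMatrix - ((d : ℂ) - 1) •
      G.reversalMatrix) * G.reversalMatrix) ^ k = G.reversalMatrix * (G.headMatrix * G.tailMatrix -
      ((d : ℂ) - 1) • G.reversalMatrix) ^ k * G.reversalMatrix :=
    Units.conj_pow ⟨_, _, hP, hP⟩ _ k
  rw [Matrix.inv_eq_left_inv hinv, smul_pow, Matrix.trace_smul, smul_eq_mul, hconj,
    Matrix.trace_mul_comm, ← Matrix.mul_assoc, hP, Matrix.one_mul,
    Matrix.trace_mul_sub_involution_pow hP (G.trace_reversalMatrix hnohalf) hUPT, ← hH, hcard]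
  have hpow : ((d : ℂ) - 1)⁻¹ ^ k * ((d : ℂ) - 1) ^ k = 1 := by
    rw [← mul_pow, inv_mul_cancel₀ hq, one_pow]
  linear_combination (1 + (-1 : ℂ) ^ k) * ((Fintype.card V : ℂ) * ((d : ℂ) - 2)) / 2 * hpow
end
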